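/- Corollary 3.2: For every natural number n, the sum over all j ≥ 0 of the squares of the labels in the n-th column of the Dyck triangle equals the n-th Catalan number: Σ_{j=0}^{n} d(n,j)² = c_n. -/

import Mathlib

open Finset

/-- Step value: `true` is an up-step (+1), `false` a down-step (−1). -/
def dyckStep (b : Bool) : ℤ := if b then 1 else -1

/-- Sum of the first `k` steps of the path `w`. -/
def dyckPSum {m : ℕ} (w : Fin m → Bool) (k : ℕ) : ℤ :=
  ∑ t ∈ Finset.univ.filter (fun t : Fin m => (t : ℕ) < k), dyckStep (w t)

/-- `dyckD i j`: the number of lattice paths of length `i` from `(0,0)` to `(i,j)`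
using steps `(1,1)` and `(1,-1)` that never go below the x-axis; equivalently the
number of `±1`-lists of length `i` all of whose partial sums are nonnegative and
whose total sum is `j`. -/
def dyckD (i j : ℕ) : ℕ :=
  (Finset.univ.filter (fun w : Fin i → Bool =>
    (∀ k ≤ i, 0 ≤ dyckPSum w k) ∧ dyckPSum w i = (j : ℤ))).card

theorem dyckPSum_snoc_of_le {m : ℕ} (w : Fin m → Bool) (b : Bool) {k : ℕ} (hk : k ≤ m) :
    dyckPSum (Fin.snoc w b : Fin (m + 1) → Bool) k = dyckPSum w k := by
  simp only [dyckPSum, Finset.sum_filter]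
  rw [Fin.sum_univ_castSucc]
  simp [hk]

theorem dyckPSum_snoc_last {m : ℕ} (w : Fin m → Bool) (b : Bool) :
    dyckPSum (Fin.snoc w b : Fin (m + 1) → Bool) (m + 1) = dyckPSum w m + dyckStep b := by
  simp only [dyckPSum, Finset.sum_filter]
  rw [Fin.sum_univ_castSucc]
  simp

theorem dyckPSum_snoc_nonneg_iff {m : ℕ} (w : Fin m → Bool) (b : Bool) (j : ℕ) :
    ((∀ k ≤ m + 1, 0 ≤ dyckPSum (Fin.snoc w b : Fin (m + 1) → Bool) k) ∧
      dyckPSum (Fin.snoc w b : Fin (m + 1) → Bool) (m + 1) = (j : ℤ)) ↔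
    (∀ k ≤ m, 0 ≤ dyckPSum w k) ∧ dyckPSum w m + dyckStep b = (j : ℤ) := by
  rw [dyckPSum_snoc_last]
  refine and_congr_left fun hj => ⟨fun h k hk => ?_, fun h k hk => ?_⟩
  · rw [← dyckPSum_snoc_of_le w b hk]
    exact h k (by lia)
  · rcases Nat.le_succ_iff.mp hk with hk | rfl
    · rw [dyckPSum_snoc_of_le w b hk]
      exact h k hk
    · rw [dyckPSum_snoc_last]
      lia

theorem dyckD_succ (i j : ℕ) :
    dyckD (i + 1) j =
      (Finset.univ.filter (fun w : Fin i → Bool =>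
        (∀ k ≤ i, 0 ≤ dyckPSum w k) ∧ dyckPSum w i + 1 = (j : ℤ))).card + dyckD i (j + 1) := by
  simp only [dyckD, Finset.card_filter]
  rw [← Equiv.sum_comp (Fin.snocEquiv fun _ : Fin (i + 1) => Bool), Fintype.sum_prod_type,
    Fintype.sum_bool]
  have h_snoc (b : Bool) (w : Fin i → Bool) :
      Fin.snocEquiv (fun _ : Fin (i + 1) => Bool) (b, w) = Fin.snoc w b := rfl
  simp only [h_snoc, dyckPSum_snoc_nonneg_iff]
  simp [dyckStep, ← sub_eq_add_neg, sub_eq_iff_eq_add]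

theorem dyckD_succ_zero (i : ℕ) : dyckD (i + 1) 0 = dyckD i 1 := by
  rw [dyckD_succ, Finset.card_eq_zero.mpr, zero_add]
  refine Finset.filter_false_of_mem fun w _ h => ?_
  have := h.1 i le_rfl
  lia

theorem dyckD_succ_succ (i j : ℕ) :
    dyckD (i + 1) (j + 1) = dyckD i j + dyckD i (j + 2) := by
  rw [dyckD_succ]
  simp [dyckD, add_assoc, one_add_one_eq_two]

theorem dyckD_zero_zero : dyckD 0 0 = 1 := by
  simp [dyckD, dyckPSum]

theorem dyckD_eq_zero_of_lt {i j : ℕ} (h : i < j) : dyckD i j = 0 := by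
  induction i generalizing j with
  | zero =>
    simp only [dyckD, dyckPSum, Finset.card_eq_zero]
    refine Finset.filter_false_of_mem fun w _ hw => ?_
    simp at hw
    lia
  | succ i ih =>
    obtain ⟨j, rfl⟩ := Nat.exists_eq_succ_of_ne_zero (Nat.ne_zero_of_lt h)
    rw [Nat.succ_eq_add_one, dyckD_succ_succ, ih (by lia), ih (by lia)]

/-- The ballot formula, as given by the reflection principle. -/
theorem dyckD_add_choose (i j k : ℕ) (h : i = j + 2 * k) :
    dyckD i j + i.choose (j + k + 1) = i.choose (j + k) := by
  induction i generalizing j k with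
  | zero =>
    obtain ⟨rfl, rfl⟩ : j = 0 ∧ k = 0 := by lia
    simp [dyckD_zero_zero]
  | succ i ih =>
    cases j with
    | zero =>
      obtain ⟨k, rfl⟩ : ∃ l, k = l + 1 := ⟨k - 1, by lia⟩
      have h1 := ih 1 k (by lia)
      have hs : i.choose k = i.choose (k + 1) := Nat.choose_symm_of_eq_add (by lia)
      simp only [dyckD_succ_zero, Nat.zero_add, Nat.choose_succ_succ'] at h1 ⊢
      rw [Nat.add_comm 1 k] at h1
      lia
    | succ j =>
      have h1 := ih j k (by lia)
      have h2 : dyckD i (j + 2) + i.choose (j + k + 2) = i.choose (j + k + 1) := by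
        cases k with
        | zero =>
          rw [dyckD_eq_zero_of_lt (by lia), Nat.choose_eq_zero_of_lt (by lia),
            Nat.choose_eq_zero_of_lt (by lia)]
        | succ k =>
          simpa only [show j + 2 + k = j + (k + 1) + 1 by lia] using ih (j + 2) k (by lia)
      rw [show j + 1 + k = j + k + 1 by lia, dyckD_succ_succ, Nat.choose_succ_succ',
        Nat.choose_succ_succ']
      lia

theorem dyckD_two_mul_zero (n : ℕ) : dyckD (2 * n) 0 = catalan n := by
  have h := dyckD_add_choose (2 * n) 0 n (by lia)
  have hc := Nat.choose_succ_right_eq (2 * n) n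
  have hcat := succ_mul_catalan_eq_centralBinom n
  rw [Nat.centralBinom] at hcat
  rw [Nat.zero_add] at h
  rw [show 2 * n - n = n by lia] at hc
  refine Nat.eq_of_mul_eq_mul_left n.succ_pos ?_
  rw [Nat.succ_eq_add_one, hcat]
  nlinarith

theorem sum_dyckD_succ_mul_add (a b N : ℕ) :
    ∑ j ∈ Finset.range (N + 1), dyckD (a + 1) j * dyckD b j + dyckD a N * dyckD b (N + 1) =
      ∑ j ∈ Finset.range (N + 1), dyckD a j * dyckD (b + 1) j +
        dyckD a (N + 1) * dyckD b N := by
  induction N with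
  | zero => simp [dyckD_succ_zero, Nat.add_comm]
  | succ N ih =>
    rw [Finset.sum_range_succ, Finset.sum_range_succ _ (N + 1), dyckD_succ_succ,
      dyckD_succ_succ]
    linarith

theorem sum_dyckD_mul_dyckD (a b N : ℕ) (h : a + b ≤ N) :
    ∑ j ∈ Finset.range (N + 1), dyckD a j * dyckD b j = dyckD (a + b) 0 := by
  induction a generalizing b with
  | zero =>
    rw [Finset.sum_range_succ', Finset.sum_eq_zero, dyckD_zero_zero]
    · simp
    · intro j _
      rw [dyckD_eq_zero_of_lt j.succ_pos, Nat.zero_mul]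
  | succ a ih =>
    have hs := sum_dyckD_succ_mul_add a b N
    rw [dyckD_eq_zero_of_lt (show a < N + 1 by lia),
      dyckD_eq_zero_of_lt (show b < N + 1 by lia), ih (b + 1) (by lia)] at hs
    rw [show a + 1 + b = a + (b + 1) by lia]
    simpa using hs

/-- Corollary 3.2: in the `n`-th column of the Dyck triangle, the sum of the
squares of the labels is the `n`-th Catalan number. -/
theorem sum_sq_column_eq_catalan (n : ℕ) :
    ∑ j ∈ Finset.range (n + 1), dyckD n j ^ 2 = catalan n := by
  rw [← dyckD_two_mul_zero, Nat.two_mul, ← sum_dyckD_mul_dyckD n n (n + n) le_rfl]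
  simp only [pow_two]
  refine Finset.sum_subset (Finset.range_mono (by lia)) fun j _ hj => ?_
  rw [dyckD_eq_zero_of_lt (by simpa using hj), Nat.zero_mul]
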